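/- Let p > 3 be a prime and let a be a rational number whose denominator is coprime to p. Then Σ_{k=0}^{p-1} C(-a,k)·C(a-1,k)·H_k ≡ (-1)^{⟨a-1⟩_p} · (2·H_{⟨a-1⟩_p} + (a − ⟨a⟩_p)·B_{p-2}(a)) (mod p²). -/

import Mathlib

open Finset

/-- Generalized binomial coefficient `C(a,k) = a(a-1)⋯(a-k+1)/k!` for a rational `a`. -/
noncomputable def gchoose (a : ℚ) (k : ℕ) : ℚ :=
  (∏ j ∈ Finset.range k, (a - j)) / (Nat.factorial k : ℚ)

/-- The harmonic number `H_k = ∑_{j=1}^k 1/j`. -/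
def harm (k : ℕ) : ℚ := ∑ j ∈ Finset.range k, (1 : ℚ) / (j + 1)

/-- The second-order harmonic number `H_k^{(2)} = ∑_{j=1}^k 1/j²`. -/
def harm2 (k : ℕ) : ℚ := ∑ j ∈ Finset.range k, (1 : ℚ) / (j + 1) ^ 2

/-- `x ≡ y (mod p^m)` for rationals: the p-adic valuation of `x - y` is at least `m`
(with the convention that the valuation of `0` is `+∞`). -/
def CongrMod (p m : ℕ) (x y : ℚ) : Prop :=
  x = y ∨ (m : ℤ) ≤ padicValRat p (x - y)

/-- The Bernoulli polynomial `B_n` evaluated at a rational `x`. -/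
noncomputable def bpoly (n : ℕ) (x : ℚ) : ℚ := (Polynomial.bernoulli n).eval x

/-- The Euler polynomial `E_n` evaluated at a rational `x`, via
`E_n(x) = (2/(n+1))·(B_{n+1}(x) − 2^{n+1}·B_{n+1}(x/2))`. -/
noncomputable def epoly (n : ℕ) (x : ℚ) : ℚ :=
  (2 / (n + 1 : ℚ)) * (bpoly (n + 1) x - 2 ^ (n + 1) * bpoly (n + 1) (x / 2))

/-- The Euler number `E_n = 2^n · E_n(1/2)`. -/
noncomputable def eulerNum (n : ℕ) : ℚ := 2 ^ n * epoly n (1 / 2)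

/-- The rationals whose `p`-adic valuation is at least `m`. -/
def padicBall (p : ℕ) [Fact p.Prime] (m : ℕ) : AddSubgroup ℚ where
  carrier := {x | padicNorm p x ≤ (p : ℚ) ^ (-m : ℤ)}
  zero_mem' := by
    simp only [Set.mem_ofPred_eq, padicNorm.zero]
    positivity
  add_mem' hx hy := padicNorm.nonarchimedean.trans (max_le hx hy)
  neg_mem' hx := by simpa [padicNorm.neg] using hx

section PadicBall

variable {p : ℕ} [Fact p.Prime]

lemma mem_padicBall {m : ℕ} {x : ℚ} :
    x ∈ padicBall p m ↔ padicNorm p x ≤ (p : ℚ) ^ (-m : ℤ) := Iff.rfl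

lemma mem_padicBall_zero {x : ℚ} : x ∈ padicBall p 0 ↔ padicNorm p x ≤ 1 := by
  simp [mem_padicBall]

lemma mul_mem_padicBall_add {m n : ℕ} {x y : ℚ} (hx : x ∈ padicBall p m)
    (hy : y ∈ padicBall p n) : x * y ∈ padicBall p (m + n) := by
  have hp : (p : ℚ) ≠ 0 := by exact_mod_cast (Fact.out : p.Prime).ne_zero
  rw [mem_padicBall] at *
  rw [padicNorm.mul, Nat.cast_add, neg_add, zpow_add₀ hp]
  exact mul_le_mul hx hy (padicNorm.nonneg _) (by positivity)

lemma mul_mem_padicBall_left {m : ℕ} {x y : ℚ} (hx : x ∈ padicBall p 0)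
    (hy : y ∈ padicBall p m) : x * y ∈ padicBall p m := by
  simpa using mul_mem_padicBall_add hx hy

lemma mul_mem_padicBall_right {m : ℕ} {x y : ℚ} (hx : x ∈ padicBall p m)
    (hy : y ∈ padicBall p 0) : x * y ∈ padicBall p m := by
  simpa using mul_mem_padicBall_add hx hy

lemma mul_mem_padicBall_two {x y : ℚ} (hx : x ∈ padicBall p 1) (hy : y ∈ padicBall p 1) :
    x * y ∈ padicBall p 2 := by
  simpa only [one_add_one_eq_two] using mul_mem_padicBall_add hx hy

lemma natCast_mem_padicBall (n : ℕ) : (n : ℚ) ∈ padicBall p 0 :=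
  mem_padicBall_zero.2 (padicNorm.of_nat n)

lemma intCast_mem_padicBall (n : ℤ) : (n : ℚ) ∈ padicBall p 0 :=
  mem_padicBall_zero.2 (padicNorm.of_int n)

lemma intCast_mem_padicBall_one {n : ℤ} : (n : ℚ) ∈ padicBall p 1 ↔ (p : ℤ) ∣ n := by
  rw [mem_padicBall, ← padicNorm.dvd_iff_norm_le, pow_one]

lemma one_mem_padicBall : (1 : ℚ) ∈ padicBall p 0 := by
  exact_mod_cast natCast_mem_padicBall (p := p) 1

lemma prime_mem_padicBall : (p : ℚ) ∈ padicBall p 1 := by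
  exact_mod_cast (intCast_mem_padicBall_one (p := p) (n := p)).2 dvd_rfl

lemma padicBall_antitone : Antitone (padicBall p) := fun m n hmn x hx => by
  rw [mem_padicBall] at *
  refine hx.trans (zpow_le_zpow_right₀ ?_ (by simpa using hmn))
  exact_mod_cast (Fact.out : p.Prime).one_le

lemma pow_mem_padicBall {x : ℚ} (hx : x ∈ padicBall p 0) (n : ℕ) : x ^ n ∈ padicBall p 0 := by
  induction n with
  | zero => simpa using one_mem_padicBall
  | succ n ih => rw [pow_succ]; exact mul_mem_padicBall_left ih hx

lemma pow_sub_pow_mem_padicBall {m : ℕ} {x y : ℚ} (hx : x ∈ padicBall p 0)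
    (hy : y ∈ padicBall p 0) (hxy : x - y ∈ padicBall p m) (n : ℕ) :
    x ^ n - y ^ n ∈ padicBall p m := by
  induction n with
  | zero => simp
  | succ n ih =>
    have : x ^ (n + 1) - y ^ (n + 1) = x ^ n * (x - y) + y * (x ^ n - y ^ n) := by ring
    rw [this]
    exact add_mem (mul_mem_padicBall_left (pow_mem_padicBall hx n) hxy)
      (mul_mem_padicBall_left hy ih)

lemma padicNorm_natCast_of_lt {i : ℕ} (hi : 0 < i) (hip : i < p) : padicNorm p (i : ℚ) = 1 :=
  (padicNorm.nat_eq_one_iff i).2 (Nat.not_dvd_of_pos_of_lt hi hip)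

lemma one_div_natCast_mem_padicBall {i : ℕ} (hi : 0 < i) (hip : i < p) :
    1 / (i : ℚ) ∈ padicBall p 0 := by
  rw [mem_padicBall_zero, padicNorm.div, padicNorm_natCast_of_lt hi hip]
  simp

lemma one_div_succ_mem_padicBall {i : ℕ} (hip : i + 1 < p) :
    1 / ((i : ℚ) + 1) ∈ padicBall p 0 := by
  exact_mod_cast one_div_natCast_mem_padicBall (p := p) i.succ_pos hip

lemma div_natCast_mem_padicBall {m i : ℕ} {x : ℚ} (hx : x ∈ padicBall p m) (hi : 0 < i)
    (hip : i < p) : x / i ∈ padicBall p m := by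
  rw [← mul_one_div]
  exact mul_mem_padicBall_right hx (one_div_natCast_mem_padicBall hi hip)

lemma padicNorm_sub_natCast_of_lt {x : ℚ} (hx : x ∈ padicBall p 1) {i : ℕ} (hi : 0 < i)
    (hip : i < p) : padicNorm p (x - i) = 1 := by
  have hlt : padicNorm p x < 1 := by
    rw [mem_padicBall] at hx
    refine hx.trans_lt ?_
    simpa using inv_lt_one_of_one_lt₀ (by exact_mod_cast (Fact.out : p.Prime).one_lt : (1 : ℚ) < p)
  have hi1 : padicNorm p (-(i : ℚ)) = 1 := by
    rw [padicNorm.neg, padicNorm_natCast_of_lt hi hip]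
  rw [sub_eq_add_neg, padicNorm.add_eq_max_of_ne (by rw [hi1]; exact hlt.ne), hi1]
  exact max_eq_right hlt.le

lemma mem_padicBall_zero_of_den {x : ℚ} (hx : ¬ p ∣ x.den) : x ∈ padicBall p 0 := by
  have := Padic.norm_rat_le_one hx
  rw [Padic.eq_padicNorm] at this
  exact mem_padicBall_zero.2 (by exact_mod_cast this)

lemma congrMod_iff_sub_mem {m : ℕ} {x y : ℚ} :
    CongrMod p m x y ↔ x - y ∈ padicBall p m := by
  have hp : (1 : ℚ) < p := by exact_mod_cast (Fact.out : p.Prime).one_lt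
  by_cases h : x = y
  · simp [CongrMod, h]
  · have h' : x - y ≠ 0 := sub_ne_zero.2 h
    rw [CongrMod, mem_padicBall, padicNorm.eq_zpow_of_nonzero h', zpow_le_zpow_iff_right₀ hp]
    simp [h]

end PadicBall

section HarmonicBinomialSums

lemma gchoose_zero (x : ℚ) : gchoose x 0 = 1 := by simp [gchoose]

lemma gchoose_succ (x : ℚ) (k : ℕ) : gchoose x (k + 1) = gchoose x k * (x - k) / (k + 1) := by
  have : (k.factorial : ℚ) ≠ 0 := by exact_mod_cast k.factorial_ne_zero
  have : (k : ℚ) + 1 ≠ 0 := by positivity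
  simp only [gchoose, prod_range_succ, Nat.factorial_succ]
  push_cast
  field_simp

lemma succ_mul_gchoose_succ (x : ℚ) (k : ℕ) :
    (k + 1) * gchoose x (k + 1) = (x - k) * gchoose x k := by
  rw [gchoose_succ]
  field_simp

lemma gchoose_add_one (x : ℚ) (k : ℕ) :
    gchoose (x + 1) (k + 1) = gchoose x (k + 1) + gchoose x k := by
  induction k with
  | zero => simp [gchoose_succ, gchoose_zero]
  | succ k ih =>
    rw [gchoose_succ (x + 1), ih, gchoose_succ x (k + 1), gchoose_succ x k]
    push_cast
    field_simp
    ring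

lemma gchoose_natCast_of_lt {n k : ℕ} (h : n < k) : gchoose n k = 0 := by
  rw [gchoose, prod_eq_zero (mem_range.2 h) (sub_self _), zero_div]

lemma add_one_mul_gchoose (x : ℚ) (k : ℕ) :
    (x + 1) * gchoose x k = (x + 1 - k) * gchoose (x + 1) k := by
  cases k with
  | zero => simp [gchoose_zero]
  | succ k =>
    rw [gchoose_add_one]
    have := succ_mul_gchoose_succ x k
    push_cast
    linear_combination this

lemma harm_succ (k : ℕ) : harm (k + 1) = harm k + 1 / (k + 1) := by
  simp [harm, sum_range_succ]

lemma sum_gchoose_recurrence (x y : ℚ) (N : ℕ) :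
    ∑ k ∈ range N, ((x + 1) * gchoose (x + 1) k - (x + 1 + y) * gchoose x k) * gchoose y k =
      -(N * (gchoose (x + 1) N - gchoose x N) * gchoose y N) := by
  induction N with
  | zero => simp
  | succ N ih =>
    rw [sum_range_succ, ih, gchoose_add_one]
    have h1 := succ_mul_gchoose_succ y N
    have h2 := add_one_mul_gchoose x N
    push_cast
    linear_combination gchoose x N * h1 - gchoose y N * h2

lemma sum_gchoose_harm_recurrence (x y : ℚ) (N : ℕ) :
    ∑ k ∈ range N,
        ((x + 1) * gchoose (x + 1) k - (x + 1 + y) * gchoose x k) * gchoose y k * harm k =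
      ∑ k ∈ range N, gchoose x k * gchoose y (k + 1) -
        N * (gchoose (x + 1) N - gchoose x N) * gchoose y N * harm N := by
  induction N with
  | zero => simp
  | succ N ih =>
    rw [sum_range_succ, sum_range_succ, ih, gchoose_add_one, harm_succ]
    have h1 := succ_mul_gchoose_succ y N
    have h2 := add_one_mul_gchoose x N
    have h3 : ((N : ℚ) + 1) * (1 / (N + 1)) = 1 := by field_simp
    push_cast
    linear_combination (gchoose x N * h1 - gchoose y N * h2) * harm N +
      gchoose x N * gchoose y (N + 1) * h3

lemma sum_gchoose_shift (x y : ℚ) (N : ℕ) :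
    ∑ k ∈ range N, ((x + 1) * (gchoose x k * gchoose y (k + 1)) - y * (gchoose x k * gchoose y k)) =
      N * gchoose x N * gchoose y N := by
  induction N with
  | zero => simp
  | succ N ih =>
    rw [sum_range_succ, ih]
    have h1 := succ_mul_gchoose_succ y N
    have h2 := succ_mul_gchoose_succ x N
    push_cast
    linear_combination gchoose x N * h1 - gchoose y (N + 1) * h2

/-- A truncated Chu–Vandermonde identity. -/
lemma sum_gchoose_mul_gchoose (y : ℚ) {n N : ℕ} (h : n < N) :
    ∑ k ∈ range N, gchoose n k * gchoose y k = ∏ j ∈ range n, (y + j + 1) / (j + 1) := by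
  induction n with
  | zero =>
    obtain ⟨N, rfl⟩ := Nat.exists_eq_succ_of_ne_zero h.ne'
    rw [sum_range_succ']
    have : ∀ k : ℕ, gchoose 0 (k + 1) = 0 := fun k => by
      exact_mod_cast gchoose_natCast_of_lt k.succ_pos
    simp [this, gchoose_zero]
  | succ n ih =>
    have key := sum_gchoose_recurrence n y N
    have h0 : gchoose ((n : ℚ) + 1) N = 0 := by exact_mod_cast gchoose_natCast_of_lt h
    rw [h0, gchoose_natCast_of_lt (by omega)] at key
    simp only [sub_mul, sum_sub_distrib, mul_assoc, ← mul_sum] at key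
    rw [ih (by omega)] at key
    rw [prod_range_succ]
    push_cast
    field_simp
    linear_combination key

/-- The harmonic analogue of the truncated Chu–Vandermonde identity. -/
lemma sum_gchoose_mul_gchoose_mul_harm (y : ℚ) {n N : ℕ} (h : n < N)
    (hy : ∀ j < n, y + j + 1 ≠ 0) :
    ∑ k ∈ range N, gchoose n k * gchoose y k * harm k =
      (∏ j ∈ range n, (y + j + 1) / (j + 1)) * (harm n - ∑ j ∈ range n, 1 / (y + j + 1)) := by
  induction n with
  | zero =>
    obtain ⟨N, rfl⟩ := Nat.exists_eq_succ_of_ne_zero h.ne'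
    rw [sum_range_succ']
    have : ∀ k : ℕ, gchoose 0 (k + 1) = 0 := fun k => by
      exact_mod_cast gchoose_natCast_of_lt k.succ_pos
    simp [this, harm]
  | succ n ih =>
    have key := sum_gchoose_harm_recurrence n y N
    have shift := sum_gchoose_shift n y N
    have h0 : gchoose ((n : ℚ) + 1) N = 0 := by exact_mod_cast gchoose_natCast_of_lt h
    rw [h0, gchoose_natCast_of_lt (by omega)] at key
    rw [gchoose_natCast_of_lt (by omega), sum_sub_distrib, ← mul_sum, ← mul_sum,
      sum_gchoose_mul_gchoose y (by omega)] at shift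
    simp only [sub_mul, sum_sub_distrib, mul_assoc, ← mul_sum] at key
    simp only [mul_assoc] at ih shift
    rw [ih (by omega) fun j hj => hy j (by omega)] at key
    have hn := hy n (by omega)
    rw [prod_range_succ, sum_range_succ, harm_succ]
    push_cast
    simp only [mul_assoc]
    have hn1 : (n : ℚ) + 1 ≠ 0 := by positivity
    refine mul_left_cancel₀ hn1 ?_
    set V := ∏ j ∈ range n, (y + j + 1) / ((j : ℚ) + 1)
    set S := ∑ j ∈ range n, 1 / (y + j + 1)
    have e : (∑ k ∈ range N, gchoose n k * gchoose y (k + 1)) = y * V / (n + 1) := by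
      rw [eq_div_iff hn1]
      linear_combination shift
    rw [e] at key
    have : (n + 1 : ℚ) * (V * ((y + n + 1) / (n + 1) *
        (harm n + 1 / (n + 1) - (S + 1 / (y + n + 1))))) =
        (n + 1 + y) * (V * (harm n - S)) + y * V / (n + 1) := by
      field_simp
      ring
    rw [this]
    linear_combination key

end HarmonicBinomialSums

section Congruences

variable {p : ℕ} [Fact p.Prime]

lemma harm_mem_padicBall {n : ℕ} (h : n < p) : harm n ∈ padicBall p 0 :=
  sum_mem fun j hj => one_div_succ_mem_padicBall (by have := mem_range.1 hj; omega)

lemma harm2_mem_padicBall {n : ℕ} (h : n < p) : harm2 n ∈ padicBall p 0 := by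
  refine sum_mem fun j hj => ?_
  rw [← one_div_pow]
  exact pow_mem_padicBall (one_div_succ_mem_padicBall (by have := mem_range.1 hj; omega)) 2

lemma gchoose_mem_padicBall {x : ℚ} (hx : x ∈ padicBall p 0) {k : ℕ} (hk : k < p) :
    gchoose x k ∈ padicBall p 0 := by
  induction k with
  | zero => rw [gchoose_zero]; exact one_mem_padicBall
  | succ k ih =>
    rw [gchoose_succ]
    exact_mod_cast div_natCast_mem_padicBall (mul_mem_padicBall_left (ih (by omega))
      (sub_mem hx (natCast_mem_padicBall k))) k.succ_pos hk

lemma gchoose_sub_gchoose_mem_padicBall {x y : ℚ} (hx : x ∈ padicBall p 0)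
    (hy : y ∈ padicBall p 0) (hxy : x - y ∈ padicBall p 1) {k : ℕ} (hk : k < p) :
    gchoose x k - gchoose y k ∈ padicBall p 1 := by
  induction k with
  | zero => simp [gchoose_zero]
  | succ k ih =>
    have : gchoose x (k + 1) - gchoose y (k + 1) =
        ((gchoose x k - gchoose y k) * (x - k) + gchoose y k * (x - y)) / ((k + 1 : ℕ) : ℚ) := by
      rw [gchoose_succ, gchoose_succ]
      push_cast
      ring
    rw [this]
    exact div_natCast_mem_padicBall (add_mem
      (mul_mem_padicBall_right (ih (by omega)) (sub_mem hx (natCast_mem_padicBall k)))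
      (mul_mem_padicBall_left (gchoose_mem_padicBall hy (by omega)) hxy)) k.succ_pos hk

/-- Modulo `p²`, the mixed second difference of the binomial-harmonic sum over increments
divisible by `p` vanishes. -/
lemma sum_gchoose_mul_harm_biaffine {x x' y y' : ℚ} (hx : x ∈ padicBall p 0)
    (hx' : x' ∈ padicBall p 0) (hy : y ∈ padicBall p 0) (hy' : y' ∈ padicBall p 0)
    (hxx : x - x' ∈ padicBall p 1) (hyy : y - y' ∈ padicBall p 1) :
    ∑ k ∈ range p, gchoose x k * gchoose y k * harm k -
      (∑ k ∈ range p, gchoose x' k * gchoose y k * harm k +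
        ∑ k ∈ range p, gchoose x k * gchoose y' k * harm k -
        ∑ k ∈ range p, gchoose x' k * gchoose y' k * harm k) ∈ padicBall p 2 := by
  rw [← sum_add_distrib, ← sum_sub_distrib, ← sum_sub_distrib]
  refine sum_mem fun k hk => ?_
  rw [mem_range] at hk
  have : gchoose x k * gchoose y k * harm k - (gchoose x' k * gchoose y k * harm k +
      gchoose x k * gchoose y' k * harm k - gchoose x' k * gchoose y' k * harm k) =
      (gchoose x k - gchoose x' k) * (gchoose y k - gchoose y' k) * harm k := by ring
  rw [this]
  exact mul_mem_padicBall_right (mul_mem_padicBall_two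
    (gchoose_sub_gchoose_mem_padicBall hx hx' hxx hk)
    (gchoose_sub_gchoose_mem_padicBall hy hy' hyy hk)) (harm_mem_padicBall hk)

lemma sq_mem_padicBall {x : ℚ} (hx : x ∈ padicBall p 1) : x ^ 2 ∈ padicBall p 2 := by
  rw [sq]
  exact mul_mem_padicBall_two hx hx

lemma neg_one_pow_mem_padicBall (n : ℕ) : (-1 : ℚ) ^ n ∈ padicBall p 0 :=
  pow_mem_padicBall (neg_mem one_mem_padicBall) n

lemma prod_sub_div_congr {e : ℚ} (he : e ∈ padicBall p 1) {n : ℕ} (hn : n < p) :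
    ∏ j ∈ range n, (e - (j + 1)) / (j + 1) - (-1) ^ n * (1 - e * harm n) ∈ padicBall p 2 := by
  induction n with
  | zero => simp [harm]
  | succ n ih =>
    have hc := one_div_succ_mem_padicBall (p := p) hn
    rw [prod_range_succ, harm_succ]
    set P := ∏ j ∈ range n, (e - (j + 1)) / ((j : ℚ) + 1)
    have hn1 : (n : ℚ) + 1 ≠ 0 := by positivity
    have : P * ((e - (n + 1)) / (n + 1)) - (-1) ^ (n + 1) * (1 - e * (harm n + 1 / (n + 1))) =
        (P - (-1) ^ n * (1 - e * harm n)) * (e * (1 / (n + 1)) - 1) -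
          (-1) ^ n * (e ^ 2 * (harm n * (1 / (n + 1)))) := by
      field_simp
      ring
    rw [this]
    exact sub_mem (mul_mem_padicBall_right (ih (by omega)) (sub_mem
      (mul_mem_padicBall_left (padicBall_antitone zero_le_one he) hc) one_mem_padicBall))
      (mul_mem_padicBall_left (neg_one_pow_mem_padicBall n) (mul_mem_padicBall_right
        (sq_mem_padicBall he) (mul_mem_padicBall_left (harm_mem_padicBall (by omega)) hc)))

lemma sum_one_div_sub_congr {e : ℚ} (he : e ∈ padicBall p 1) {n : ℕ} (hn : n < p) :
    ∑ j ∈ range n, 1 / (e - (j + 1)) + (harm n + e * harm2 n) ∈ padicBall p 2 := by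
  rw [harm, harm2, mul_sum, ← sum_add_distrib, ← sum_add_distrib]
  refine sum_mem fun j hj => ?_
  have hj' : j + 1 < p := by have := mem_range.1 hj; omega
  have hnorm := padicNorm_sub_natCast_of_lt he j.succ_pos hj'
  push_cast at hnorm
  have hne : e - ((j : ℚ) + 1) ≠ 0 := fun h => by simp [h] at hnorm
  have hj1 : (j : ℚ) + 1 ≠ 0 := by positivity
  have : 1 / (e - (j + 1)) + (1 / (j + 1) + e * (1 / ((j : ℚ) + 1) ^ 2)) =
      e ^ 2 * ((1 / (j + 1)) ^ 2 * (1 / (e - (j + 1)))) := by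
    field_simp
    ring
  rw [this]
  refine mul_mem_padicBall_right (sq_mem_padicBall he) (mul_mem_padicBall_left
    (pow_mem_padicBall (one_div_succ_mem_padicBall hj') 2) ?_)
  rw [mem_padicBall_zero, padicNorm.div, hnorm]
  simp

/-- The binomial-harmonic sum at `(n, -n - 1 + e)` with `e` divisible by `p`, modulo `p²`. -/
lemma sum_gchoose_harm_congr {e y : ℚ} (he : e ∈ padicBall p 1) {n : ℕ} (hn : n < p)
    (hy : y = e - n - 1) :
    ∑ k ∈ range p, gchoose n k * gchoose y k * harm k -
      (-1) ^ n * (2 * harm n + e * (harm2 n - 2 * harm n ^ 2)) ∈ padicBall p 2 := by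
  have hreflect : ∀ j < n, y + j + 1 = e - ((n - 1 - j : ℕ) + 1) := fun j hj => by
    have : ((n - 1 - j : ℕ) : ℚ) + 1 = n - j := by
      rw [eq_sub_iff_add_eq]
      exact_mod_cast (by omega : n - 1 - j + 1 + j = n)
    rw [this, hy]
    ring
  have hne : ∀ j < n, y + j + 1 ≠ 0 := fun j hj h => by
    have := padicNorm_sub_natCast_of_lt he (n - 1 - j).succ_pos (by omega)
    push_cast at this
    rw [← hreflect j hj, h, padicNorm.zero] at this
    exact zero_ne_one this
  have hprod : ∏ j ∈ range n, (y + j + 1) / ((j : ℚ) + 1) =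
      ∏ j ∈ range n, (e - (j + 1)) / ((j : ℚ) + 1) := by
    rw [prod_div_distrib, prod_div_distrib]
    congr 1
    rw [← prod_range_reflect (fun j : ℕ => e - ((j : ℚ) + 1))]
    exact prod_congr rfl fun j hj => hreflect j (mem_range.1 hj)
  have hsum : ∑ j ∈ range n, 1 / (y + j + 1) = ∑ j ∈ range n, 1 / (e - ((j : ℚ) + 1)) := by
    rw [← sum_range_reflect (fun j : ℕ => 1 / (e - ((j : ℚ) + 1)))]
    exact sum_congr rfl fun j hj => by rw [hreflect j (mem_range.1 hj)]
  rw [sum_gchoose_mul_gchoose_mul_harm y hn hne, hprod, hsum]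
  have hP := prod_sub_div_congr he hn
  have hS := sum_one_div_sub_congr he hn
  have hH := harm_mem_padicBall hn
  have hH2 := harm2_mem_padicBall hn
  have he0 := padicBall_antitone zero_le_one he
  set P := ∏ j ∈ range n, (e - (j + 1)) / ((j : ℚ) + 1)
  set S := ∑ j ∈ range n, 1 / (e - ((j : ℚ) + 1))
  have hP0 : (-1) ^ n * (1 - e * harm n) ∈ padicBall p 0 :=
    mul_mem_padicBall_left (neg_one_pow_mem_padicBall n)
      (sub_mem one_mem_padicBall (mul_mem_padicBall_left he0 hH))
  have hT : 2 * harm n + e * harm2 n ∈ padicBall p 0 :=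
    add_mem (mul_mem_padicBall_left (by exact_mod_cast natCast_mem_padicBall (p := p) 2) hH)
      (mul_mem_padicBall_left he0 hH2)
  have : P * (harm n - S) - (-1) ^ n * (2 * harm n + e * (harm2 n - 2 * harm n ^ 2)) =
      (P - (-1) ^ n * (1 - e * harm n)) * (2 * harm n + e * harm2 n - (S + (harm n + e * harm2 n)))
        - (-1) ^ n * (1 - e * harm n) * (S + (harm n + e * harm2 n))
        - (-1) ^ n * (e ^ 2 * (harm n * harm2 n)) := by ring
  rw [this]
  exact sub_mem (sub_mem (mul_mem_padicBall_right hP (sub_mem hT (padicBall_antitone (Nat.zero_le 2) hS)))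
    (mul_mem_padicBall_left hP0 hS)) (mul_mem_padicBall_left (neg_one_pow_mem_padicBall n)
      (mul_mem_padicBall_right (sq_mem_padicBall he) (mul_mem_padicBall_left hH hH2)))

lemma bernoulli'_mem_padicBall {n : ℕ} (hn : n + 1 < p) : bernoulli' n ∈ padicBall p 0 := by
  induction n using Nat.strong_induction_on with
  | _ n ih =>
    rw [bernoulli'_def]
    refine sub_mem one_mem_padicBall (sum_mem fun k hk => ?_)
    rw [mem_range] at hk
    have : (n : ℚ) - k + 1 = ((n - k + 1 : ℕ) : ℚ) := by
      rw [Nat.cast_add, Nat.cast_sub hk.le, Nat.cast_one]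
    rw [this]
    exact mul_mem_padicBall_left (div_natCast_mem_padicBall (natCast_mem_padicBall _)
      (Nat.succ_pos _) (by omega)) (ih k hk (by omega))

lemma bernoulli_mem_padicBall {n : ℕ} (hn : n + 1 < p) : bernoulli n ∈ padicBall p 0 :=
  mul_mem_padicBall_left (neg_one_pow_mem_padicBall n) (bernoulli'_mem_padicBall hn)

lemma bpoly_sub_bpoly_mem_padicBall {x y : ℚ} (hx : x ∈ padicBall p 0) (hy : y ∈ padicBall p 0)
    (hxy : x - y ∈ padicBall p 1) {n : ℕ} (hn : n + 1 < p) :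
    bpoly n x - bpoly n y ∈ padicBall p 1 := by
  simp only [bpoly, Polynomial.bernoulli, Polynomial.eval_finsetSum, Polynomial.eval_monomial]
  rw [← sum_sub_distrib]
  refine sum_mem fun i hi => ?_
  rw [← mul_sub]
  rw [mem_range] at hi
  exact mul_mem_padicBall_left (mul_mem_padicBall_left (bernoulli_mem_padicBall (by omega))
    (natCast_mem_padicBall _)) (pow_sub_pow_mem_padicBall hx hy hxy _)

lemma pow_sub_one_div_sq_mem_padicBall (hp3 : 3 < p) {i : ℕ} (hi : 0 < i) (hip : i < p) :
    (i : ℚ) ^ (p - 3) - 1 / (i : ℚ) ^ 2 ∈ padicBall p 1 := by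
  have hi0 : (i : ℚ) ≠ 0 := by positivity
  have hcop : IsCoprime (i : ℤ) p :=
    Nat.isCoprime_iff_coprime.2
      (Nat.coprime_of_lt_prime hi.ne' hip Fact.out).symm
  have h := (intCast_mem_padicBall_one (p := p)).2 (Int.prime_dvd_pow_sub_one Fact.out hcop)
  push_cast at h
  have : (i : ℚ) ^ (p - 3) - 1 / (i : ℚ) ^ 2 = ((i : ℚ) ^ (p - 1) - 1) * (1 / i) ^ 2 := by
    rw [show p - 1 = p - 3 + 2 by omega, pow_add]
    field_simp
  rw [this]
  exact mul_mem_padicBall_right h (pow_mem_padicBall (one_div_natCast_mem_padicBall hi hip) 2)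

lemma bernoulli_sub_two_eq_zero (hp3 : 3 < p) : bernoulli (p - 2) = 0 := by
  have hodd := (Fact.out : p.Prime).odd_of_ne_two (by omega)
  refine bernoulli_eq_zero_of_odd ?_ (by omega)
  rw [Nat.odd_iff] at *
  omega

lemma bpoly_succ_add_harm2_mem_padicBall (hp3 : 3 < p) {s : ℕ} (hs : s < p) :
    bpoly (p - 2) ((s : ℚ) + 1) + 2 * harm2 s ∈ padicBall p 1 := by
  have h := Polynomial.sum_range_pow_eq_bernoulli_sub (s + 1) (p - 3)
  rw [show (p - 3).succ = p - 2 by omega, bernoulli_sub_two_eq_zero hp3, sub_zero,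
    sum_range_succ', Nat.cast_zero, zero_pow (by omega), add_zero,
    show ((p - 3 : ℕ) : ℚ) + 1 = p - 2 by
      rw [Nat.cast_sub (by omega)]; push_cast; ring] at h
  have hdiff : ∑ k ∈ range s, ((k + 1 : ℕ) : ℚ) ^ (p - 3) - harm2 s ∈ padicBall p 1 := by
    rw [harm2, ← sum_sub_distrib]
    refine sum_mem fun j hj => ?_
    rw [mem_range] at hj
    have := pow_sub_one_div_sq_mem_padicBall hp3 j.succ_pos (by omega)
    push_cast at this ⊢
    exact this
  rw [Nat.cast_succ] at h
  rw [bpoly, ← h]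
  set T := ∑ k ∈ range s, ((k + 1 : ℕ) : ℚ) ^ (p - 3)
  have : ((p : ℚ) - 2) * T + 2 * harm2 s = (p - 2 : ℚ) * (T - harm2 s) + p * harm2 s := by ring
  rw [this]
  exact add_mem (mul_mem_padicBall_left (by exact_mod_cast intCast_mem_padicBall (p := p) (p - 2))
    hdiff) (mul_mem_padicBall_right prime_mem_padicBall (harm2_mem_padicBall hs))

lemma mem_padicBall_of_two_mul (hp3 : 3 < p) {m : ℕ} {x : ℚ} (h : 2 * x ∈ padicBall p m) :
    x ∈ padicBall p m := by
  simpa using div_natCast_mem_padicBall h (i := 2) two_pos (by omega)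

lemma harm2_pred_mem_padicBall (hp3 : 3 < p) : harm2 (p - 1) ∈ padicBall p 1 := by
  have h0 : bpoly (p - 2) 0 = 0 := by
    rw [bpoly, Polynomial.bernoulli_eval_zero, bernoulli_sub_two_eq_zero hp3]
  have h1 := bpoly_succ_add_harm2_mem_padicBall hp3 (s := p - 1) (by omega)
  have hp1 : ((p - 1 : ℕ) : ℚ) + 1 = p := by
    exact_mod_cast (by omega : p - 1 + 1 = p)
  rw [hp1] at h1
  have h2 := bpoly_sub_bpoly_mem_padicBall (natCast_mem_padicBall p) (zero_mem (padicBall p 0))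
    (by simpa using prime_mem_padicBall (p := p)) (n := p - 2) (by omega)
  refine mem_padicBall_of_two_mul hp3 ?_
  convert sub_mem h1 h2 using 1
  rw [h0]
  ring

/-- Splitting `H_{p-1}` and reflecting the upper part. -/
lemma harm_reflect (hp3 : 3 < p) {s : ℕ} (hs : s < p) :
    harm (p - 1) - (harm (p - 1 - s) - (harm s + p * harm2 s)) ∈ padicBall p 2 := by
  have h := sum_one_div_sub_congr (prime_mem_padicBall (p := p)) hs
  have hsplit : harm (p - 1) = harm (p - 1 - s) + ∑ j ∈ range s, 1 / ((p : ℚ) - (j + 1)) := by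
    conv_lhs => rw [show p - 1 = p - 1 - s + s by omega]
    rw [harm, sum_range_add, ← harm, ← sum_range_reflect (fun j : ℕ => 1 / ((p : ℚ) - (j + 1)))]
    congr 1
    refine sum_congr rfl fun j hj => ?_
    rw [mem_range] at hj
    congr 1
    rw [eq_sub_iff_add_eq]
    exact_mod_cast (by omega : p - 1 - s + j + 1 + (s - 1 - j + 1) = p)
  rw [hsplit]
  convert h using 1
  ring

lemma harm_pred_mem_padicBall (hp3 : 3 < p) : harm (p - 1) ∈ padicBall p 2 := by
  have h := harm_reflect hp3 (s := p - 1) (by omega)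
  rw [Nat.sub_self, show harm 0 = 0 by simp [harm]] at h
  have h2 := mul_mem_padicBall_two prime_mem_padicBall (harm2_pred_mem_padicBall hp3)
  refine mem_padicBall_of_two_mul hp3 ?_
  convert sub_mem h h2 using 1
  ring

lemma harm_sub_congr (hp3 : 3 < p) {s : ℕ} (hs : s < p) :
    harm (p - 1 - s) - (harm s + p * harm2 s) ∈ padicBall p 2 := by
  convert sub_mem (harm_pred_mem_padicBall hp3) (harm_reflect hp3 hs) using 1
  ring

lemma harm2_sub_congr (hp3 : 3 < p) {s : ℕ} (hs : s < p) :
    harm2 (p - 1 - s) + harm2 s ∈ padicBall p 1 := by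
  have hsplit : harm2 (p - 1) =
      harm2 (p - 1 - s) + ∑ j ∈ range s, 1 / ((p - (j + 1) : ℕ) : ℚ) ^ 2 := by
    conv_lhs => rw [show p - 1 = p - 1 - s + s by omega]
    rw [harm2, sum_range_add, ← harm2,
      ← sum_range_reflect (fun j : ℕ => 1 / ((p - (j + 1) : ℕ) : ℚ) ^ 2)]
    congr 1
    refine sum_congr rfl fun j hj => ?_
    rw [mem_range] at hj
    congr 2
    exact_mod_cast (by omega : p - 1 - s + j + 1 = p - (s - 1 - j + 1))
  have hdiff : ∑ j ∈ range s, 1 / ((p - (j + 1) : ℕ) : ℚ) ^ 2 - harm2 s ∈ padicBall p 1 := by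
    rw [harm2, ← sum_sub_distrib]
    refine sum_mem fun j hj => ?_
    rw [mem_range] at hj
    have hx := one_div_natCast_mem_padicBall (p := p) (i := p - (j + 1)) (by omega) (by omega)
    have hy := one_div_natCast_mem_padicBall (p := p) (i := j + 1) (by omega) (by omega)
    have hxy : 1 / ((p - (j + 1) : ℕ) : ℚ) - -(1 / ((j + 1 : ℕ) : ℚ)) ∈ padicBall p 1 := by
      have hp0 : ((p - (j + 1) : ℕ) : ℚ) ≠ 0 := by exact_mod_cast (by omega : p - (j + 1) ≠ 0)
      have hj0 : ((j + 1 : ℕ) : ℚ) ≠ 0 := by positivity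
      have hsum : (p : ℚ) = (p - (j + 1) : ℕ) + (j + 1 : ℕ) := by
        exact_mod_cast (by omega : p = p - (j + 1) + (j + 1))
      have : 1 / ((p - (j + 1) : ℕ) : ℚ) - -(1 / ((j + 1 : ℕ) : ℚ)) =
          p * (1 / ((p - (j + 1) : ℕ) : ℚ) * (1 / ((j + 1 : ℕ) : ℚ))) := by
        rw [hsum]
        field_simp
        ring
      rw [this]
      exact mul_mem_padicBall_right prime_mem_padicBall (mul_mem_padicBall_left hx hy)
    convert pow_sub_pow_mem_padicBall hx (neg_mem hy) hxy 2 using 1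
    rw [neg_sq, one_div_pow, one_div_pow]
    push_cast
    rfl
  convert sub_mem (harm2_pred_mem_padicBall hp3) hdiff using 1
  rw [hsplit]
  ring

end Congruences

theorem stmt_1 (p : ℕ) (hp : p.Prime) (hp3 : 3 < p) (a : ℚ) (ha : ¬ (p ∣ a.den))
    (r s : ℕ) (hr : r < p) (hs : s < p)
    (har : CongrMod p 1 a r) (has : CongrMod p 1 (a - 1) s) :
    CongrMod p 2
      (∑ k ∈ Finset.range p, gchoose (-a) k * gchoose (a - 1) k * harm k)
      ((-1 : ℚ) ^ s * (2 * harm s + (a - r) * bpoly (p - 2) a)) := by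
  have : Fact p.Prime := ⟨hp⟩
  rw [congrMod_iff_sub_mem] at *
  have ha0 : a ∈ padicBall p 0 := mem_padicBall_zero_of_den ha
  obtain ⟨n, hn⟩ : ∃ n, n = p - 1 - s := ⟨_, rfl⟩
  have hnp : n < p := by omega
  have hns : (n : ℚ) = p - 1 - s := by
    have : ((n + 1 + s : ℕ) : ℚ) = p := by exact_mod_cast (by omega : n + 1 + s = p)
    push_cast at this
    linear_combination this
  have hpB := prime_mem_padicBall (p := p)
  have hx0 : a - 1 ∈ padicBall p 0 := sub_mem ha0 one_mem_padicBall
  have hyy : -a - n ∈ padicBall p 1 := by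
    convert neg_mem (add_mem has hpB) using 1
    rw [hns]
    ring
  have haff := sum_gchoose_mul_harm_biaffine hx0 (natCast_mem_padicBall s) (neg_mem ha0)
    (natCast_mem_padicBall n) has hyy
  have h1 := sum_gchoose_harm_congr (neg_mem has) hs (y := -a) (by ring)
  have h2 := sum_gchoose_harm_congr (add_mem has hpB) hnp (y := a - 1) (by rw [hns]; ring)
  have h3 := sum_gchoose_harm_congr hpB hs (y := n) (by rw [hns]; ring)
  have hδ := harm_sub_congr hp3 hs
  have hε := harm2_sub_congr hp3 hs
  rw [← hn] at hδ hε
  have hβ : bpoly (p - 2) a + 2 * harm2 s ∈ padicBall p 1 := by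
    convert add_mem (bpoly_sub_bpoly_mem_padicBall ha0
      (add_mem (natCast_mem_padicBall s) one_mem_padicBall) (by convert has using 1; ring)
      (n := p - 2) (by omega)) (bpoly_succ_add_harm2_mem_padicBall hp3 hs) using 1
    ring
  have hη : harm n - harm s ∈ padicBall p 1 := by
    convert add_mem (padicBall_antitone one_le_two hδ)
      (mul_mem_padicBall_right hpB (harm2_mem_padicBall hs)) using 1
    ring
  have hγ : (a - r - (a - 1 - s)) * harm2 s ∈ padicBall p 2 := by
    have hmem := sub_mem har has
    have hint : a - r - (a - 1 - s) = ((s + 1 - r : ℤ) : ℚ) := by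
      push_cast
      ring
    by_cases hsp : s = p - 1
    · exact mul_mem_padicBall_two hmem (hsp ▸ harm2_pred_mem_padicBall hp3)
    · rw [hint, intCast_mem_padicBall_one] at hmem
      have : (s + 1 - r : ℤ) = 0 := Int.eq_zero_of_abs_lt_dvd hmem (by rw [abs_lt]; omega)
      rw [hint, this]
      simp
  have hsign : (-1 : ℚ) ^ n = (-1) ^ s := by
    have hodd := hp.odd_of_ne_two (by omega)
    rw [Nat.odd_iff] at hodd
    exact neg_one_pow_congr (by rw [Nat.even_iff, Nat.even_iff]; omega)
  have two_mem : (2 : ℚ) ∈ padicBall p 0 := by exact_mod_cast natCast_mem_padicBall (p := p) 2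
  have hbracket : 2 * (harm n - (harm s + p * harm2 s)) +
      (a - 1 - s + p) * (harm2 n + harm2 s - 2 * ((harm n - harm s) * (harm n + harm s))) -
      (a - r) * (bpoly (p - 2) a + 2 * harm2 s) +
      2 * ((a - r - (a - 1 - s)) * harm2 s) ∈ padicBall p 2 := by
    have hsum := add_mem (harm_mem_padicBall hnp) (harm_mem_padicBall hs)
    exact add_mem (sub_mem (add_mem (mul_mem_padicBall_left two_mem hδ)
      (mul_mem_padicBall_two (add_mem has hpB) (sub_mem hε
        (mul_mem_padicBall_left two_mem (mul_mem_padicBall_right hη hsum)))))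
      (mul_mem_padicBall_two har hβ)) (mul_mem_padicBall_left two_mem hγ)
  rw [hsign] at h2
  have hcomm : ∀ x y : ℚ, ∑ k ∈ range p, gchoose x k * gchoose y k * harm k =
      ∑ k ∈ range p, gchoose y k * gchoose x k * harm k := fun x y =>
    sum_congr rfl fun k _ => by rw [mul_comm (gchoose x k)]
  rw [hcomm n] at h2
  rw [hcomm (-a)]
  convert add_mem (add_mem haff (sub_mem (add_mem h1 h2) h3))
    (mul_mem_padicBall_left (neg_one_pow_mem_padicBall s) hbracket) using 1
  ring
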